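/- Let r be a fixed positive real number and let I be a set of nonnegative real numbers satisfying the descending chain condition (DCC). Let J := {m_1 a_1 + ... + m_k a_k : k ≥ 1, m_i positive integers, a_i ∈ I} be the set of all ℕ-linear combinations of elements of I. Then the set {(r − b)/d : b ∈ J, b ≤ r, d ∈ J, d > 0} satisfies the ascending chain condition (ACC). (This is the combined arithmetic conclusion of the final step of the proof of Theorem 3.1: with −K_{F'}·M_{F'}^{dim F'−1} bounded by r, b = Δ'|_{F'}·M_{F'}^{dim F'−1} ∈ J, and d = D'|_{F'}·M_{F'}^{dim F'−1} ∈ J, the pseudoeffective thresholds t_eff = (r − b)/d belong to an ACC set.) -/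

import Mathlib

/-- A set `S` of real numbers satisfies the ascending chain condition (ACC) if it
contains no infinite strictly increasing sequence. -/
def SatisfiesACC (S : Set ℝ) : Prop :=
  ¬ ∃ f : ℕ → ℝ, (∀ n, f n ∈ S) ∧ StrictMono f

/-- A set `S` of real numbers satisfies the descending chain condition (DCC) if it
contains no infinite strictly decreasing sequence. -/
def SatisfiesDCC (S : Set ℝ) : Prop :=
  ¬ ∃ f : ℕ → ℝ, (∀ n, f n ∈ S) ∧ StrictAnti f

/-- The set of all ℕ-linear combinations `m₁ a₁ + ⋯ + m_k a_k` with `k ≥ 1`, the `mᵢ`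
positive integers and `aᵢ ∈ I`; equivalently, all sums over nonempty finite lists of
elements of `I`. -/
def natLinComb (I : Set ℝ) : Set ℝ :=
  {x : ℝ | ∃ l : List ℝ, l ≠ [] ∧ (∀ a ∈ l, a ∈ I) ∧ x = l.sum}

theorem SatisfiesDCC.isPWO {I : Set ℝ} (hI : SatisfiesDCC I) : I.IsPWO := by
  rw [Set.isPWO_iff_isWF, Set.isWF_iff_no_descending_seq]
  intro f hf hmem
  exact hI ⟨f, fun n => hmem n, hf⟩

theorem natLinComb_subset_closure (I : Set ℝ) :
    natLinComb I ⊆ AddSubmonoid.closure I := by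
  rintro x ⟨l, -, hl, rfl⟩
  exact AddSubmonoid.list_sum_mem _ fun a ha => AddSubmonoid.subset_closure (hl a ha)

theorem isPWO_natLinComb {I : Set ℝ} (hI0 : ∀ a ∈ I, 0 ≤ a) (hI : SatisfiesDCC I) :
    (natLinComb I).IsPWO :=
  (hI.isPWO.addSubmonoid_closure hI0).mono (natLinComb_subset_closure I)

/-- Let `r > 0` and let `I` be a DCC set of nonnegative reals, with `J` the set of all
ℕ-linear combinations of elements of `I`. Then `{(r - b)/d : b ∈ J, b ≤ r, d ∈ J, d > 0}`
satisfies the ACC. -/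
theorem acc_thresholds (r : ℝ) (hr : 0 < r) (I : Set ℝ) (hI0 : ∀ a ∈ I, 0 ≤ a)
    (hI : SatisfiesDCC I) :
    SatisfiesACC {x : ℝ | ∃ b ∈ natLinComb I, ∃ d ∈ natLinComb I,
      b ≤ r ∧ 0 < d ∧ x = (r - b) / d} := by
  rintro ⟨f, hf, hmono⟩
  choose b hb d hd hbr hd0 hfeq using hf
  have hJ := isPWO_natLinComb hI0 hI
  obtain ⟨g, hg⟩ := (hJ.prod hJ).exists_monotone_subseq (f := fun n => (b n, d n))
    fun n => ⟨hb n, hd n⟩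
  have hle := hg (Nat.zero_le 1)
  have hlt := hmono (g.strictMono Nat.zero_lt_one)
  rw [hfeq, hfeq] at hlt
  refine hlt.not_ge (div_le_div₀ (sub_nonneg.2 (hbr _)) ?_ (hd0 _) hle.2)
  exact sub_le_sub_left hle.1 r
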